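/- Let q be an odd prime. Then q² does not occur as a Lucas number L_k for any k ≥ 2; that is, there is no index k ≥ 2 with L_k = q², where the Lucas sequence is defined by L₀ = 2, L₁ = 1, L_{k+2} = L_k + L_{k+1}. -/

import Mathlib

/-- The Lucas sequence: `L₀ = 2`, `L₁ = 1`, `L_{k+2} = L_k + L_{k+1}`. -/
def lucas : ℕ → ℕ
  | 0 => 2
  | 1 => 1
  | k + 2 => lucas k + lucas (k + 1)

theorem lucas_add_two (k : ℕ) : lucas (k + 2) = lucas k + lucas (k + 1) := by
  rw [lucas]

theorem lucas_mul_lucas_add (k : ℕ) : ∀ m : ℕ,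
    (lucas k * lucas (m + k) : ℤ) = lucas (m + 2 * k) + (-1) ^ k * lucas m := by
  induction k using Nat.twoStepInduction with
  | zero => intro m; simp [lucas]; ring
  | one =>
    intro m
    simp only [lucas]
    push_cast
    ring
  | more k ih₀ ih₁ =>
    intro m
    have h₀ := ih₀ (m + 2)
    have h₁ := ih₁ (m + 1)
    have hk := lucas_add_two k
    have hm := lucas_add_two m
    have hs := lucas_add_two (m + 2 * k + 2)
    rw [show m + 2 + k = m + (k + 2) by ring, show m + 2 + 2 * k = m + 2 * k + 2 by ring] at h₀
    rw [show m + 1 + (k + 1) = m + (k + 2) by ring,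
      show m + 1 + 2 * (k + 1) = m + 2 * k + 2 + 1 by ring] at h₁
    rw [show m + 2 * (k + 2) = m + 2 * k + 2 + 2 by ring, hs, hk]
    rw [hm] at h₀
    push_cast at h₀ h₁ ⊢
    rw [add_mul, h₀, h₁]
    ring

/-- The doubling formula for Lucas numbers. -/
theorem lucas_sq (k : ℕ) : (lucas k ^ 2 : ℤ) = lucas (2 * k) + 2 * (-1) ^ k := by
  have h := lucas_mul_lucas_add k 0
  simp only [zero_add, lucas] at h
  push_cast at h
  linarith

theorem lucas_two_pow_mod_four (r : ℕ) : lucas (2 ^ (r + 1)) % 4 = 3 := by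
  induction r with
  | zero => simp [lucas]
  | succ r ih =>
    have h := lucas_sq (2 ^ (r + 1))
    rw [(even_two.pow_of_ne_zero r.succ_ne_zero).neg_one_pow, ← pow_succ'] at h
    obtain ⟨t, ht⟩ : ∃ t : ℤ, (lucas (2 ^ (r + 1)) : ℤ) = 4 * t + 3 :=
      ⟨lucas (2 ^ (r + 1)) / 4, by lia⟩
    rw [ht] at h
    ring_nf at h ⊢
    lia

theorem lucas_dvd_lucas_add_odd_mul {k : ℕ} (hk : Even k) (m i : ℕ) :
    (lucas k : ℤ) ∣ lucas (m + 2 * k * (2 * i + 1)) + lucas m := by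
  have step (n : ℕ) : (lucas k : ℤ) ∣ lucas (n + 2 * k) + lucas n :=
    ⟨lucas (n + k), by rw [lucas_mul_lucas_add, hk.neg_one_pow, one_mul]⟩
  induction i with
  | zero => simpa using step m
  | succ i ih =>
    have h₁ := step (m + 2 * k * (2 * i + 1))
    have h₂ := step (m + 2 * k * (2 * i + 1) + 2 * k)
    rw [show m + 2 * k * (2 * (i + 1) + 1) = m + 2 * k * (2 * i + 1) + 2 * k + 2 * k by ring]
    have h := dvd_add (dvd_sub h₂ h₁) ih
    rwa [add_comm (lucas (m + 2 * k * (2 * i + 1) + 2 * k) : ℤ), add_sub_add_right_eq_sub,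
      ← add_assoc, sub_add_cancel] at h

theorem not_dvd_sq_add_sq_of_mod_four_eq_three {M : ℕ} (hM : M % 4 = 3) (a : ℤ) {c : ℤ}
    (hc : c.gcd M = 1) : ¬ (M : ℤ) ∣ a ^ 2 + c ^ 2 := by
  intro h
  have hmod : a ^ 2 % M = (-1 * c ^ 2) % M :=
    Int.emod_eq_emod_iff_emod_sub_eq_zero.mpr (Int.emod_eq_zero_of_dvd (by simpa using h))
  have hJ : jacobiSym (a ^ 2) M = jacobiSym (-1 * c ^ 2) M := jacobiSym.mod_left' hmod
  rw [jacobiSym.mul_left, jacobiSym.sq_one' hc, jacobiSym.at_neg_one (Nat.odd_iff.mpr (by lia)),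
    ZMod.χ₄_nat_three_mod_four hM, jacobiSym.pow_left] at hJ
  nlinarith [sq_nonneg (jacobiSym a M)]

theorem lucas_add_four_mul_ne_sq {c m : ℕ} (hm : lucas m = c ^ 2)
    (hc : ∀ M : ℕ, Odd M → c.Coprime M) {t : ℕ} (ht : t ≠ 0) (a : ℕ) :
    lucas (m + 4 * t) ≠ a ^ 2 := by
  intro h
  obtain ⟨r, s, ⟨i, rfl⟩, rfl⟩ := Nat.exists_eq_two_pow_mul_odd ht
  have hM := lucas_two_pow_mod_four r
  have hd := lucas_dvd_lucas_add_odd_mul (even_two.pow_of_ne_zero r.succ_ne_zero) m i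
  rw [show m + 2 * 2 ^ (r + 1) * (2 * i + 1) = m + 4 * (2 ^ r * (2 * i + 1)) by ring, h, hm] at hd
  push_cast at hd
  exact not_dvd_sq_add_sq_of_mod_four_eq_three hM a
    (by simpa using hc _ (Nat.odd_iff.mpr (by lia))) hd

/-- For an odd prime `q`, the square `q²` does not occur as a Lucas number `L_k` with
`k ≥ 2`. -/
theorem q_sq_not_lucas (q : ℕ) (hq : q.Prime) (hqodd : Odd q) :
    ∀ k : ℕ, 2 ≤ k → lucas k ≠ q ^ 2 := by
  intro k hk h
  have hq4 : q ^ 2 % 4 = 1 := by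
    obtain ⟨s, rfl⟩ := hqodd
    ring_nf
    lia
  obtain ⟨t, ht⟩ | hodd := Nat.even_or_odd k
  · have hd := lucas_sq t
    rw [two_mul, ← ht, h] at hd
    have hx : (lucas t : ℤ) ^ 2 % 4 = 0 ∨ (lucas t : ℤ) ^ 2 % 4 = 1 := by
      obtain he | ho := Int.even_or_odd (lucas t : ℤ)
      · exact .inl (Int.emod_eq_zero_of_dvd (by simpa using pow_dvd_pow_of_dvd he.two_dvd 2))
      · exact .inr (Int.sq_mod_four_eq_one_of_odd ho)
    zify at hq4
    push_cast at hd
    obtain hs | hs := neg_one_pow_eq_or ℤ t <;> rw [hs] at hd <;> lia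
  · have hk4 : k % 4 = 1 ∨ k % 4 = 3 := by
      obtain ⟨s, rfl⟩ := hodd
      lia
    obtain h1 | h3 := hk4
    · obtain ⟨t, rfl⟩ : ∃ t, k = 1 + 4 * t := ⟨k / 4, by lia⟩
      exact lucas_add_four_mul_ne_sq (c := 1) (by simp [lucas]) (by simp) (by lia) q h
    · obtain ⟨t, rfl⟩ : ∃ t, k = 3 + 4 * t := ⟨k / 4, by lia⟩
      obtain rfl | ht := eq_or_ne t 0
      · simp only [lucas] at h
        lia
      · exact lucas_add_four_mul_ne_sq (c := 2) (by simp [lucas])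
          (fun _ hM => Nat.coprime_two_left.mpr hM) ht q h
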